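/- arXiv:1509.03269 — 2 statements merged into one kernel-verified Lean document; each statement's English description precedes it below -/
import Mathlib

section
/- Let R be a commutative ring in which q(q²−1) is invertible and let r ≥ 0. In the group algebra R[G_{r+4}] set e = e_{r+4,r} and T = q²·e·σ·e, where σ ∈ G_{r+4} is the permutation matrix of (1,2)(r+3,r+4). Then T² = (q²−1)·T + q²·e. -/
open scoped MatrixGroups Matrix

noncomputable section

variable (F : Type*) [Field F]

/-- The anti-diagonal matrix `J` with entries 1 at positions `(i, n-1-i)`. -/
def Jmat (n : ℕ) : Matrix (Fin n) (Fin n) F :=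
  Matrix.of fun i j => if j = Fin.rev i then 1 else 0

lemma Jmat_mul_self (n : ℕ) : Jmat F n * Jmat F n = 1 := by
  ext i j
  rw [Matrix.mul_apply]
  simp only [Jmat, Matrix.of_apply, Matrix.one_apply]
  rw [Finset.sum_eq_single (Fin.rev i)]
  · simp [Fin.rev_rev, eq_comm]
  · intro k _ hk
    rw [if_neg hk, zero_mul]
  · exact fun h => absurd (Finset.mem_univ _) h

/-- `J` as an element of the general linear group. -/
def Junit (n : ℕ) : GL (Fin n) F :=
  ⟨Jmat F n, Jmat F n, Jmat_mul_self F n, Jmat_mul_self F n⟩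

/-- The group automorphism `g ↦ ᵗg⁻¹` of `GL_n`. -/
def transposeInvHom (n : ℕ) : GL (Fin n) F →* GL (Fin n) F where
  toFun g := ⟨(g⁻¹).valᵀ, g.valᵀ,
    by rw [← Matrix.transpose_mul, ← Units.val_mul, mul_inv_cancel, Units.val_one,
      Matrix.transpose_one],
    by rw [← Matrix.transpose_mul, ← Units.val_mul, inv_mul_cancel, Units.val_one,
      Matrix.transpose_one]⟩
  map_one' := by
    apply Units.ext
    show ((1 : GL (Fin n) F)⁻¹).valᵀ = _
    simp
  map_mul' g h := by
    apply Units.ext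
    show ((g * h)⁻¹).valᵀ = (g⁻¹).valᵀ * (h⁻¹).valᵀ
    rw [mul_inv_rev, Units.val_mul, Matrix.transpose_mul]

/-- The twisted Frobenius endomorphism `g ↦ J · ᵗ(φ(g))⁻¹ · J` of `GL_n(F)`,
where `φ` is the `q`-power Frobenius. -/
def twistedFrobenius (φ : F →+* F) (n : ℕ) : GL (Fin n) F →* GL (Fin n) F :=
  (MulAut.conj (Junit F n)).toMonoidHom.comp
    ((transposeInvHom F n).comp (Matrix.GeneralLinearGroup.map φ))

/-- The finite unitary group `GU_n(q)`, as the subgroup of `GL_n(𝔽_{q²})` of fixed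
points of the twisted Frobenius, i.e. `g = J · ᵗ(g^{(q)})⁻¹ · J`. -/
def GU (φ : F →+* F) (n : ℕ) : Subgroup (GL (Fin n) F) where
  carrier := {g | twistedFrobenius F φ n g = g}
  one_mem' := by simp
  mul_mem' := by
    intro a b ha hb
    simp only [Set.mem_setOf_eq] at *
    rw [map_mul, ha, hb]
  inv_mem' := by
    intro a ha
    simp only [Set.mem_setOf_eq] at *
    rw [map_inv, ha]

/-- The permutation matrix of a permutation `w`. -/
def permMat (n : ℕ) (w : Equiv.Perm (Fin n)) : Matrix (Fin n) (Fin n) F :=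
  Matrix.of fun i j => if w i = j then 1 else 0

/-- The set of matrices underlying the subgroup `U_r ≤ G_{r+2}`: upper triangular
matrices whose middle `r × r` block is the identity. -/
def UrSet (r : ℕ) : Set (Matrix (Fin (r + 2)) (Fin (r + 2)) F) :=
  {g | (∀ i j : Fin (r + 2), (j : ℕ) < (i : ℕ) → g i j = 0) ∧
       (∀ i : Fin (r + 2), 1 ≤ (i : ℕ) → (i : ℕ) ≤ r → g i i = 1) ∧
       (∀ i j : Fin (r + 2), 1 ≤ (i : ℕ) → (i : ℕ) < (j : ℕ) → (j : ℕ) ≤ r → g i j = 0)}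

/-- Entries of the `o`-fold middle-block (centered) embedding of a matrix. -/
def cembFun {a : ℕ} (o : ℕ) (u : Matrix (Fin a) (Fin a) F) (p q : ℕ) : F :=
  if h : o ≤ p ∧ p < o + a ∧ o ≤ q ∧ q < o + a then
    u ⟨p - o, by omega⟩ ⟨q - o, by omega⟩
  else if p = q then 1 else 0

/-- The subgroup `U_{n,r} ≤ G_n` (for `n = r + 2m`), generated by `U_{n-2}` together with
the images of `U_{n-4}, …, U_r` under the iterated middle-block embeddings. -/
def Unr (φ : F →+* F) (r m : ℕ) : Subgroup (GU F φ (r + 2 * m)) :=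
  Subgroup.closure
    {g | ∃ k : ℕ, k < m ∧
      ∃ u : Matrix (Fin (r + 2 * k + 2)) (Fin (r + 2 * k + 2)) F,
        u ∈ UrSet F (r + 2 * k) ∧
        ∀ p q : Fin (r + 2 * m),
          ((g : GL (Fin (r + 2 * m)) F) : Matrix (Fin (r + 2 * m)) (Fin (r + 2 * m)) F) p q
            = cembFun F (m - 1 - k) u (p : ℕ) (q : ℕ)}

/-- The idempotent `e_S = |S|⁻¹ ∑_{g ∈ S} g` in the group algebra `R[G]`. -/
def eSub (R : Type*) [CommRing R] {G : Type*} [Group G] (S : Subgroup G) :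
    MonoidAlgebra R G :=
  Ring.inverse ((Nat.card S : R)) • ∑ᶠ g : S, MonoidAlgebra.of R G (g : G)

end

section HeckeAlgebra

variable {R G : Type*} [CommRing R] [Group G]

lemma of_mul_eSub [Finite G] (S : Subgroup G) {g : G} (hg : g ∈ S) :
    MonoidAlgebra.of R G g * eSub R S = eSub R S := by
  have := Fintype.ofFinite S
  rw [eSub, mul_smul_comm, finsum_eq_sum_of_fintype, Finset.mul_sum]
  congr 1
  refine Fintype.sum_equiv (Equiv.mulLeft (⟨g, hg⟩ : S)) _ _ fun x => ?_
  rw [← map_mul]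
  rfl

lemma eSub_mul_of [Finite G] (S : Subgroup G) {g : G} (hg : g ∈ S) :
    eSub R S * MonoidAlgebra.of R G g = eSub R S := by
  have := Fintype.ofFinite S
  rw [eSub, smul_mul_assoc, finsum_eq_sum_of_fintype, Finset.sum_mul]
  congr 1
  refine Fintype.sum_equiv (Equiv.mulRight (⟨g, hg⟩ : S)) _ _ fun x => ?_
  rw [← map_mul]
  rfl

lemma mul_eSub_mul (S : Subgroup G) [Fintype S] (x y : MonoidAlgebra R G) :
    x * eSub R S * y =
      Ring.inverse (Nat.card S : R) • ∑ u : S, x * MonoidAlgebra.of R G (u : G) * y := by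
  rw [eSub, finsum_eq_sum_of_fintype, mul_smul_comm, smul_mul_assoc, Finset.mul_sum,
    Finset.sum_mul]

lemma eSub_mul_eSub [Finite G] (S : Subgroup G) (hS : IsUnit (Nat.card S : R)) :
    eSub R S * eSub R S = eSub R S := by
  have := Fintype.ofFinite S
  have h := mul_eSub_mul (R := R) S (eSub R S) 1
  simp only [mul_one, eSub_mul_of S (Subtype.prop _)] at h
  rw [h, Finset.sum_const, Finset.card_univ, ← Nat.card_eq_fintype_card,
    ← Nat.cast_smul_eq_nsmul R, smul_smul, Ring.inverse_mul_cancel _ hS, one_smul]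

/-- The quadratic relation of a rank one Hecke algebra: `σ` is an involution, every `σ u σ` lies in
`S ∪ S σ S`, and `S ∩ σ S σ` has index `Q` in `S`. -/
theorem eSub_quadratic_relation [Finite G] (S : Subgroup G) (σ : G) (Q : ℕ)
    (hS : ∀ u ∈ S, σ * u * σ ∈ S ∨ ∃ b ∈ S, ∃ c ∈ S, σ * u * σ = b * σ * c)
    (hQ : Nat.card S = Q * Nat.card {u : S // σ * u * σ ∈ S}) :
    ((Q : R) • (eSub R S * MonoidAlgebra.of R G σ * eSub R S)) *
        ((Q : R) • (eSub R S * MonoidAlgebra.of R G σ * eSub R S)) =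
      ((Q : R) - 1) • ((Q : R) • (eSub R S * MonoidAlgebra.of R G σ * eSub R S)) +
        (Q : R) • eSub R S := by
  classical
  by_cases hN : IsUnit (Nat.card S : R)
  swap
  · have h0 : eSub R S = 0 := by rw [eSub, Ring.inverse_non_unit _ hN, zero_smul]
    simp [h0]
  have := Fintype.ofFinite S
  set e := eSub R S with he
  set s := MonoidAlgebra.of R G σ
  have hee : e * e = e := eSub_mul_eSub S hN
  have hterm : ∀ u : S, e * s * MonoidAlgebra.of R G (u : G) * (s * e) =
      if σ * u * σ ∈ S then e else e * s * e := by
    intro u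
    have h1 : e * s * MonoidAlgebra.of R G (u : G) * (s * e) =
        e * MonoidAlgebra.of R G (σ * u * σ) * e := by
      simp only [map_mul, mul_assoc, s]
    rw [h1]
    split_ifs with h
    · rw [eSub_mul_of S h, hee]
    · obtain h' | ⟨b, hb, c, hc, h'⟩ := hS u u.2
      · exact absurd h' h
      · rw [h', map_mul, map_mul, ← mul_assoc, ← mul_assoc, eSub_mul_of S hb, mul_assoc,
          of_mul_eSub S hc]
  set M := Nat.card {u : S // σ * u * σ ∈ S} with hM
  have hprod : (e * s * e) * (e * s * e) = Ring.inverse (Nat.card S : R) •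
      ((M : R) • e + ((Nat.card S : R) - M) • (e * s * e)) := by
    have h2 : (e * s * e) * (e * s * e) = e * s * e * (s * e) := by
      rw [show (e * s * e) * (e * s * e) = e * s * (e * e) * (s * e) by simp only [mul_assoc], hee]
    rw [h2, mul_eSub_mul, Finset.sum_congr rfl fun u _ => hterm u, Finset.sum_ite,
      Finset.sum_const, Finset.sum_const]
    have hc1 : (Finset.univ.filter fun u : S => σ * u * σ ∈ S).card = M := by
      rw [hM, Nat.card_eq_fintype_card, Fintype.card_subtype]
    have hc2 : ((Finset.univ.filter fun u : S => ¬ σ * u * σ ∈ S).card : R) =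
        (Nat.card S : R) - M := by
      rw [← hc1, Nat.card_eq_fintype_card, ← Finset.card_univ,
        ← Finset.card_filter_add_card_filter_not (s := Finset.univ) fun u : S => σ * u * σ ∈ S]
      push_cast
      ring
    rw [hc1, ← Nat.cast_smul_eq_nsmul R, ← Nat.cast_smul_eq_nsmul R (Finset.card _), hc2]
  rw [smul_mul_smul_comm, hprod]
  have hinv := Ring.inverse_mul_cancel _ hN
  have hQ' : (Nat.card S : R) = Q * M := by rw [hQ]; push_cast; rfl
  generalize Ring.inverse (Nat.card S : R) = i at *
  rw [hQ'] at *
  have h1 : (Q : R) * Q * (i * M) = Q := by linear_combination (Q : R) * hinv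
  have h2 : (Q : R) * Q * i * (Q * M - M) = (Q - 1) * Q := by
    linear_combination ((Q : R) * Q - Q) * hinv
  rw [smul_add, smul_add, smul_smul, smul_smul, smul_smul, smul_smul, smul_smul, mul_assoc, h1,
    h2, add_comm]

end HeckeAlgebra

noncomputable section UnitaryGroup

variable {F : Type*} [Field F] {φ : F →+* F} {n : ℕ}

lemma Jmat_mul_apply (M : Matrix (Fin n) (Fin n) F) (i j : Fin n) :
    (Jmat F n * M) i j = M i.rev j := by
  simp [Matrix.mul_apply, Jmat]

lemma mul_Jmat_apply (M : Matrix (Fin n) (Fin n) F) (i j : Fin n) :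
    (M * Jmat F n) i j = M i j.rev := by
  rw [Matrix.mul_apply, Finset.sum_eq_single j.rev]
  · simp [Jmat]
  · intro k _ hk
    have : j ≠ k.rev := fun h => hk (by rw [h, Fin.rev_rev])
    simp [Jmat, this]
  · exact fun h => absurd (Finset.mem_univ _) h

lemma twistedFrobenius_apply (g : GL (Fin n) F) (i j : Fin n) :
    (twistedFrobenius F φ n g).val i j = φ ((g⁻¹).val j.rev i.rev) := by
  have h : (twistedFrobenius F φ n g).val =
      Jmat F n * ((Matrix.GeneralLinearGroup.map φ g)⁻¹.val)ᵀ * Jmat F n := rfl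
  rw [h, mul_Jmat_apply, Jmat_mul_apply, Matrix.transpose_apply, ← map_inv]
  rfl

lemma mem_GU_iff {g : GL (Fin n) F} :
    g ∈ GU F φ n ↔ ∀ i j, g.val i j = φ ((g⁻¹).val j.rev i.rev) := by
  simp only [← twistedFrobenius_apply]
  constructor
  · intro h i j
    rw [show twistedFrobenius F φ n g = g from h]
  · intro h
    exact Units.ext (Matrix.ext fun i j => (h i j).symm)

lemma GU_apply (g : GU F φ n) (i j : Fin n) :
    g.val.val i j = φ ((g⁻¹).val.val j.rev i.rev) :=
  mem_GU_iff.1 g.2 i j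

lemma GU_inv_apply (g : GU F φ n) (i j : Fin n) :
    (g⁻¹).val.val i j = φ (g.val.val j.rev i.rev) := by
  simpa using GU_apply g⁻¹ i j

variable (F φ n) in
/-- The subgroup of upper triangular elements of `GU_n(q)`. -/
def upperGU : Subgroup (GU F φ n) where
  carrier := {g | ∀ i j, j < i → g.val.val i j = 0}
  one_mem' := fun i j h => Matrix.one_apply_ne h.ne'
  mul_mem' := by
    intro a b ha hb i j hij
    change (a.val.val * b.val.val) i j = 0
    rw [Matrix.mul_apply]
    refine Finset.sum_eq_zero fun k _ => ?_
    obtain h | h := lt_or_ge k i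
    · rw [ha i k h, zero_mul]
    · rw [hb k j (hij.trans_le h), mul_zero]
  inv_mem' := by
    intro a ha i j hij
    rw [GU_inv_apply, ha _ _ (Fin.rev_lt_rev.2 hij), map_zero]

/-- Keep the middle block of a matrix obtained by cutting off `c` rows and columns on every side,
and replace the rest by the identity. -/
def midMatrix (c : ℕ) (M : Matrix (Fin n) (Fin n) F) : Matrix (Fin n) (Fin n) F :=
  Matrix.of fun i j =>
    if c ≤ (i : ℕ) ∧ (i : ℕ) + c < n ∧ c ≤ (j : ℕ) ∧ (j : ℕ) + c < n then M i j
    else if i = j then 1 else 0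

lemma midMatrix_of_mem {c : ℕ} (M : Matrix (Fin n) (Fin n) F) {i j : Fin n}
    (h : c ≤ (i : ℕ) ∧ (i : ℕ) + c < n ∧ c ≤ (j : ℕ) ∧ (j : ℕ) + c < n) :
    midMatrix c M i j = M i j := if_pos h

lemma midMatrix_of_not_mem {c : ℕ} (M : Matrix (Fin n) (Fin n) F) {i j : Fin n}
    (h : ¬(c ≤ (i : ℕ) ∧ (i : ℕ) + c < n ∧ c ≤ (j : ℕ) ∧ (j : ℕ) + c < n)) :
    midMatrix c M i j = if i = j then 1 else 0 := if_neg h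

lemma midMatrix_one (c : ℕ) : midMatrix c (1 : Matrix (Fin n) (Fin n) F) = 1 := by
  ext i j
  simp [midMatrix, Matrix.one_apply]

lemma midMatrix_midMatrix (c : ℕ) (M : Matrix (Fin n) (Fin n) F) :
    midMatrix c (midMatrix c M) = midMatrix c M := by
  ext i j
  simp only [midMatrix, Matrix.of_apply]
  split_ifs <;> rfl

lemma midMatrix_mul (c : ℕ) {M N : Matrix (Fin n) (Fin n) F}
    (hM : ∀ i j, j < i → M i j = 0) (hN : ∀ i j, j < i → N i j = 0) :
    midMatrix c (M * N) = midMatrix c M * midMatrix c N := by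
  ext i j
  rw [Matrix.mul_apply]
  by_cases hi : c ≤ (i : ℕ) ∧ (i : ℕ) + c < n
  · by_cases hj : c ≤ (j : ℕ) ∧ (j : ℕ) + c < n
    · rw [midMatrix_of_mem _ ⟨hi.1, hi.2, hj⟩, Matrix.mul_apply]
      refine Finset.sum_congr rfl fun k _ => ?_
      by_cases hk : c ≤ (k : ℕ) ∧ (k : ℕ) + c < n
      · rw [midMatrix_of_mem _ ⟨hi.1, hi.2, hk⟩, midMatrix_of_mem _ ⟨hk.1, hk.2, hj⟩]
      · have hik : i ≠ k := by rintro rfl; exact hk hi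
        rw [midMatrix_of_not_mem M (i := i) (j := k) (by tauto), if_neg hik, zero_mul]
        obtain h | h := lt_or_ge k i
        · rw [hM i k h, zero_mul]
        · rw [hN k j (Fin.lt_def.2 (by have := Fin.le_def.1 h; omega)), mul_zero]
    · rw [Finset.sum_eq_single j]
      · rw [midMatrix_of_not_mem _ (by tauto), midMatrix_of_not_mem _ (by tauto),
          midMatrix_of_not_mem _ (by tauto), if_pos rfl, mul_one]
      · intro k _ hk
        rw [midMatrix_of_not_mem N (by tauto), if_neg hk, mul_zero]
      · exact fun h => absurd (Finset.mem_univ _) h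
  · rw [Finset.sum_eq_single i]
    · rw [midMatrix_of_not_mem _ (by tauto), midMatrix_of_not_mem _ (by tauto),
        midMatrix_of_not_mem _ (by tauto), if_pos rfl, one_mul]
    · intro k _ hk
      rw [midMatrix_of_not_mem M (by tauto), if_neg hk.symm, zero_mul]
    · exact fun h => absurd (Finset.mem_univ _) h

lemma midMatrix_upper (c : ℕ) {M : Matrix (Fin n) (Fin n) F} (hM : ∀ i j, j < i → M i j = 0)
    (i j : Fin n) (hij : j < i) : midMatrix c M i j = 0 := by
  simp only [midMatrix, Matrix.of_apply, hM i j hij, hij.ne', if_false, ite_self]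

lemma midMatrix_rev (c : ℕ) (g : GU F φ n) (i j : Fin n) :
    midMatrix c g.val.val i j = φ (midMatrix c (g⁻¹).val.val j.rev i.rev) := by
  have := i.2
  have := j.2
  by_cases h : c ≤ (i : ℕ) ∧ (i : ℕ) + c < n ∧ c ≤ (j : ℕ) ∧ (j : ℕ) + c < n
  · rw [midMatrix_of_mem _ h, midMatrix_of_mem _ (by simp only [Fin.val_rev]; omega), GU_apply]
  · rw [midMatrix_of_not_mem _ h, midMatrix_of_not_mem _ (by simp only [Fin.val_rev]; omega)]
    by_cases hij : i = j
    · simp [hij]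
    · simp [hij, Ne.symm hij]

/-- Projection of the upper triangular unitary group to a middle block. -/
def midHom (c : ℕ) : upperGU F φ n →* upperGU F φ n where
  toFun g :=
    ⟨⟨⟨midMatrix c g.val.val.val, midMatrix c (g⁻¹).val.val.val, by
        rw [← midMatrix_mul c g.2 (g⁻¹).2, ← midMatrix_one c]
        congr 1
        exact g.val.val.mul_inv, by
        rw [← midMatrix_mul c (g⁻¹).2 g.2, ← midMatrix_one c]
        congr 1
        exact g.val.val.inv_mul⟩, mem_GU_iff.2 (midMatrix_rev c g.val)⟩,
      midMatrix_upper c g.2⟩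
  map_one' := Subtype.ext (Subtype.ext (Units.ext (midMatrix_one c)))
  map_mul' g h := Subtype.ext (Subtype.ext (Units.ext (midMatrix_mul c g.2 h.2)))

lemma midHom_val (c : ℕ) (g : upperGU F φ n) :
    (midHom c g).val.val.val = midMatrix c g.val.val.val := rfl

lemma midHom_midHom (c : ℕ) (g : upperGU F φ n) : midHom c (midHom c g) = midHom c g :=
  Subtype.ext (Subtype.ext (Units.ext (midMatrix_midMatrix c _)))

lemma mem_ker_midHom {c : ℕ} {g : upperGU F φ n} :
    g ∈ (midHom c : upperGU F φ n →* _).ker ↔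
      ∀ i j : Fin n, c ≤ (i : ℕ) → (i : ℕ) + c < n → c ≤ (j : ℕ) → (j : ℕ) + c < n →
        g.val.val.val i j = if i = j then 1 else 0 := by
  rw [MonoidHom.mem_ker]
  constructor
  · intro h i j h1 h2 h3 h4
    have h5 := congrFun (congrFun (congrArg (fun x : upperGU F φ n => x.val.val.val) h) i) j
    rw [midHom_val] at h5
    simp only [midMatrix, Matrix.of_apply] at h5
    rw [if_pos ⟨h1, h2, h3, h4⟩] at h5
    rw [h5]
    exact Matrix.one_apply
  · intro h
    refine Subtype.ext (Subtype.ext (Units.ext (Matrix.ext fun i j => ?_)))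
    rw [midHom_val]
    refine Eq.trans ?_ Matrix.one_apply.symm
    simp only [midMatrix, Matrix.of_apply]
    by_cases h' : c ≤ (i : ℕ) ∧ (i : ℕ) + c < n ∧ c ≤ (j : ℕ) ∧ (j : ℕ) + c < n
    · rw [if_pos h', h i j h'.1 h'.2.1 h'.2.2.1 h'.2.2.2]
    · rw [if_neg h']

lemma Unr_two_eq (r : ℕ) :
    Unr F φ r 2 = (midHom 2 : upperGU F φ (r + 2 * 2) →* _).ker.map (Subgroup.subtype _) := by
  apply le_antisymm
  · refine (Subgroup.closure_le _).2 ?_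
    rintro g ⟨k, hk, u, ⟨hu1, hu2, hu3⟩, hg⟩
    have hup : g ∈ upperGU F φ (r + 2 * 2) := by
      intro i j hij
      rw [hg]
      have := Fin.lt_def.1 hij
      unfold cembFun
      split_ifs with h1 h2
      · exact hu1 _ _ (by simp only; omega)
      · omega
      · rfl
    refine ⟨⟨g, hup⟩, mem_ker_midHom.2 fun i j h1 h2 h3 h4 => ?_, rfl⟩
    obtain hij | rfl | hij := lt_trichotomy i j
    · rw [if_neg hij.ne]
      have := Fin.lt_def.1 hij
      refine (hg i j).trans ?_
      unfold cembFun
      rw [dif_pos (by omega)]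
      exact hu3 _ _ (by simp only; omega) (by simp only; omega) (by simp only; omega)
    · rw [if_pos rfl]
      refine (hg i i).trans ?_
      unfold cembFun
      rw [dif_pos (by omega)]
      exact hu2 _ (by simp only; omega) (by simp only; omega)
    · rw [if_neg hij.ne']
      exact hup i j hij
  · rintro _ ⟨g, hg, rfl⟩
    have hg' := mem_ker_midHom.1 hg
    rw [← inv_mul_cancel_right g (midHom 1 g), map_mul]
    refine mul_mem (Subgroup.subset_closure ⟨1, by norm_num, ?_⟩)
      (Subgroup.subset_closure ⟨0, by norm_num, ?_⟩)
    · have hk : g * (midHom 1 g)⁻¹ ∈ (midHom 1 : upperGU F φ (r + 2 * 2) →* _).ker := by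
        rw [MonoidHom.mem_ker, map_mul, map_inv, midHom_midHom, mul_inv_cancel]
      generalize g * (midHom 1 g)⁻¹ = x at hk
      have hk' := mem_ker_midHom.1 hk
      refine ⟨x.val.val.val, ⟨fun i j hij => x.2 i j hij, fun i h1 h2 => ?_,
        fun i j h1 h2 h3 => ?_⟩, fun i j => ?_⟩
      · exact (hk' i i h1 (by omega) h1 (by omega)).trans (if_pos rfl)
      · exact (hk' i j h1 (by omega) (by omega) (by omega)).trans
          (if_neg (Fin.ne_of_lt h2))
      · unfold cembFun
        rw [dif_pos (by have := i.2; have := j.2; omega)]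
        rfl
    · refine ⟨g.val.val.val.submatrix (fun i => ⟨i + 1, by omega⟩) (fun i => ⟨i + 1, by omega⟩),
        ⟨fun i j hij => g.2 _ _ (Fin.lt_def.2 (by simp only; omega)), fun i h1 h2 => ?_,
          fun i j h1 h2 h3 => ?_⟩, fun i j => ?_⟩
      · exact (hg' _ _ (by simp only; omega) (by simp only; omega) (by simp only; omega)
          (by simp only; omega)).trans (if_pos rfl)
      · exact (hg' _ _ (by simp only; omega) (by simp only; omega) (by simp only; omega)
          (by simp only; omega)).trans (if_neg (by simp only [Fin.mk.injEq]; omega))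
      · change midMatrix 1 g.val.val.val i j = _
        simp only [midMatrix, Matrix.of_apply, cembFun]
        by_cases h : 1 ≤ (i : ℕ) ∧ (i : ℕ) + 1 < r + 2 * 2 ∧ 1 ≤ (j : ℕ) ∧
            (j : ℕ) + 1 < r + 2 * 2
        · rw [if_pos h, dif_pos (by omega)]
          rw [Matrix.submatrix_apply]
          exact congrArg₂ _ (Fin.ext (by dsimp only; omega)) (Fin.ext (by dsimp only; omega))
        · rw [if_neg h, dif_neg (by omega)]
          simp only [Fin.ext_iff]

/-- `U_{r+4,r}` consists of the upper triangular unitary matrices with trivial middle block. -/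
lemma mem_Unr_two {r : ℕ} {g : GU F φ (r + 2 * 2)} :
    g ∈ Unr F φ r 2 ↔ (∀ i j, j < i → g.val.val i j = 0) ∧
      ∀ i j : Fin (r + 2 * 2), 2 ≤ (i : ℕ) → (i : ℕ) < r + 2 → 2 ≤ (j : ℕ) → (j : ℕ) < r + 2 →
        g.val.val i j = if i = j then 1 else 0 := by
  rw [Unr_two_eq]
  constructor
  · rintro ⟨x, hx, rfl⟩
    exact ⟨x.2, fun i j h1 h2 h3 h4 =>
      mem_ker_midHom.1 hx i j h1 (by omega) h3 (by omega)⟩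
  · rintro ⟨h1, h2⟩
    exact ⟨⟨g, h1⟩, mem_ker_midHom.2 fun i j a b c d => h2 i j a (by omega) c (by omega), rfl⟩

lemma upperGU_mul_apply_self {g h : GU F φ n} (hg : g ∈ upperGU F φ n) (hh : h ∈ upperGU F φ n)
    (i : Fin n) : (g * h).val.val i i = g.val.val i i * h.val.val i i := by
  change (g.val.val * h.val.val) i i = _
  rw [Matrix.mul_apply, Finset.sum_eq_single i]
  · intro k _ hk
    obtain h' | h' := lt_or_gt_of_ne hk
    · rw [hg i k h', zero_mul]
    · rw [hh k i h', mul_zero]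
  · exact fun h => absurd (Finset.mem_univ _) h

lemma upperGU_mul_apply_succ {g h : GU F φ n} (hg : g ∈ upperGU F φ n) (hh : h ∈ upperGU F φ n)
    {i j : Fin n} (hij : (j : ℕ) = i + 1) :
    (g * h).val.val i j =
      g.val.val i i * h.val.val i j + g.val.val i j * h.val.val j j := by
  change (g.val.val * h.val.val) i j = _
  rw [Matrix.mul_apply, Finset.sum_eq_add i j (Fin.ne_of_lt (Fin.lt_def.2 (by omega)))]
  · rintro k _ ⟨h1, h2⟩
    obtain h' | h' := lt_or_gt_of_ne h1
    · rw [hg i k h', zero_mul]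
    · rw [hh k j (lt_of_le_of_ne (Fin.le_def.2 (by have := Fin.lt_def.1 h'; omega)) h2.symm),
        mul_zero]
  · exact fun h => absurd (Finset.mem_univ _) h
  · exact fun h => absurd (Finset.mem_univ _) h

lemma upperGU_diag_mul_inv {g : GU F φ n} (hg : g ∈ upperGU F φ n) (i : Fin n) :
    g.val.val i i * (g⁻¹).val.val i i = 1 := by
  rw [← upperGU_mul_apply_self hg (inv_mem hg), mul_inv_cancel]
  exact Matrix.one_apply_eq i

lemma upperGU_diag_ne_zero {g : GU F φ n} (hg : g ∈ upperGU F φ n) (i : Fin n) :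
    g.val.val i i ≠ 0 :=
  left_ne_zero_of_mul_eq_one (upperGU_diag_mul_inv hg i)

lemma upperGU_apply_rev_eq_zero {g : GU F φ n} (hg : g ∈ upperGU F φ n) {i j : Fin n}
    (hij : (j : ℕ) = i + 1) (h : g.val.val i j = 0) : g.val.val j.rev i.rev = 0 := by
  have h1 := upperGU_mul_apply_succ hg (inv_mem hg) hij
  rw [mul_inv_cancel, h, zero_mul, add_zero] at h1
  have h2 : (1 : Matrix (Fin n) (Fin n) F) i j = 0 :=
    Matrix.one_apply_ne (Fin.ne_of_lt (Fin.lt_def.2 (by omega)))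
  have h3 := (mul_eq_zero.1 (h1.symm.trans h2)).resolve_left (upperGU_diag_ne_zero hg i)
  rw [GU_apply, Fin.rev_rev, Fin.rev_rev, h3, map_zero]

lemma permMat_mul_apply (w : Equiv.Perm (Fin n)) (M : Matrix (Fin n) (Fin n) F) (i j : Fin n) :
    (permMat F n w * M) i j = M (w i) j := by
  simp [Matrix.mul_apply, permMat]

lemma mul_permMat_apply (w : Equiv.Perm (Fin n)) (M : Matrix (Fin n) (Fin n) F) (i j : Fin n) :
    (M * permMat F n w) i (w j) = M i j := by
  simp [Matrix.mul_apply, permMat]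

/-- The permutation `(1,2)(r+3,r+4)`, in zero-based indexing. -/
def endSwap (r : ℕ) : Equiv.Perm (Fin (r + 2 * 2)) :=
  Equiv.swap ⟨0, by omega⟩ ⟨1, by omega⟩ * Equiv.swap ⟨r + 2, by omega⟩ ⟨r + 3, by omega⟩

lemma endSwap_val {r : ℕ} (i : Fin (r + 2 * 2)) :
    (endSwap r i : ℕ) = if (i : ℕ) = 0 then 1 else if (i : ℕ) = 1 then 0 else
      if (i : ℕ) = r + 2 then r + 3 else if (i : ℕ) = r + 3 then r + 2 else i := by
  simp only [endSwap, Equiv.Perm.mul_apply, Equiv.swap_apply_def, Fin.ext_iff]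
  split_ifs <;> simp_all

lemma endSwap_endSwap {r : ℕ} (i : Fin (r + 2 * 2)) : endSwap r (endSwap r i) = i := by
  apply Fin.ext
  have h1 := endSwap_val i
  have h2 := endSwap_val (endSwap r i)
  split_ifs at h1 h2 <;> omega

lemma conj_endSwap_apply {r : ℕ} {σ : GU F φ (r + 2 * 2)}
    (hσ : σ.val.val = permMat F (r + 2 * 2) (endSwap r)) (u : GU F φ (r + 2 * 2))
    (i j : Fin (r + 2 * 2)) :
    (σ * u * σ).val.val i j = u.val.val (endSwap r i) (endSwap r j) := by
  change (σ.val.val * u.val.val * σ.val.val) i j = _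
  rw [hσ, ← endSwap_endSwap j, mul_permMat_apply, permMat_mul_apply, endSwap_endSwap]

lemma conj_endSwap_mem_iff {r : ℕ} {σ : GU F φ (r + 2 * 2)}
    (hσ : σ.val.val = permMat F (r + 2 * 2) (endSwap r)) {u : GU F φ (r + 2 * 2)}
    (hu : u ∈ Unr F φ r 2) :
    σ * u * σ ∈ Unr F φ r 2 ↔ u.val.val ⟨0, by omega⟩ ⟨1, by omega⟩ = 0 := by
  obtain ⟨hu1, hu2⟩ := mem_Unr_two.1 hu
  constructor
  · intro h
    have h1 := (mem_Unr_two.1 h).1 ⟨1, by omega⟩ ⟨0, by omega⟩ (Fin.lt_def.2 Nat.zero_lt_one)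
    rw [conj_endSwap_apply hσ] at h1
    convert h1 using 2 <;> exact Fin.ext (by rw [endSwap_val]; simp)
  · intro h
    have h' := upperGU_apply_rev_eq_zero (show u ∈ upperGU F φ _ from hu1) (by simp) h
    refine mem_Unr_two.2 ⟨fun i j hij => ?_, fun i j h1 h2 h3 h4 => ?_⟩
    · rw [conj_endSwap_apply hσ]
      have hi := endSwap_val i
      have hj := endSwap_val j
      have hij' := Fin.lt_def.1 hij
      by_cases hlt : endSwap r j < endSwap r i
      · exact hu1 _ _ hlt
      · rw [Fin.lt_def] at hlt
        by_cases hi1 : (i : ℕ) = 1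
        · convert h using 2 <;> apply Fin.ext <;> dsimp only <;> split_ifs at hi hj <;> omega
        · convert h' using 2 <;> apply Fin.ext <;> simp only [Fin.val_rev] <;>
            split_ifs at hi hj <;> omega
    · rw [conj_endSwap_apply hσ]
      have hi : endSwap r i = i := by
        apply Fin.ext
        rw [endSwap_val]
        split_ifs <;> omega
      have hj : endSwap r j = j := by
        apply Fin.ext
        rw [endSwap_val]
        split_ifs <;> omega
      rw [hi, hj, hu2 i j h1 h2 h3 h4]

/-- The decomposition of the indices into the first two, the middle ones and the last two. -/
def blockEquiv (r : ℕ) : (Fin 2 ⊕ Fin r) ⊕ Fin 2 ≃ Fin (r + 2 * 2) :=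
  ((Equiv.sumCongr finSumFinEquiv (Equiv.refl _)).trans finSumFinEquiv).trans
    (finCongr (by omega))

lemma blockEquiv_left {r : ℕ} (a : Fin 2) : (blockEquiv r (.inl (.inl a)) : ℕ) = a := by
  simp [blockEquiv]

lemma blockEquiv_mid {r : ℕ} (a : Fin r) : (blockEquiv r (.inl (.inr a)) : ℕ) = 2 + a := by
  simp [blockEquiv]

lemma blockEquiv_right {r : ℕ} (a : Fin 2) : (blockEquiv r (.inr a) : ℕ) = 2 + r + a := by
  simp [blockEquiv, add_comm]

/-- The block diagonal matrix `diag(A, 1, B)`. -/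
def blockMatrix (r : ℕ) (A B : Matrix (Fin 2) (Fin 2) F) :
    Matrix (Fin (r + 2 * 2)) (Fin (r + 2 * 2)) F :=
  Matrix.reindexAlgEquiv F F (blockEquiv r)
    (Matrix.fromBlocks (Matrix.fromBlocks A 0 0 1) 0 0 B)

lemma blockMatrix_apply {r : ℕ} (A B : Matrix (Fin 2) (Fin 2) F)
    (x y : (Fin 2 ⊕ Fin r) ⊕ Fin 2) :
    blockMatrix r A B (blockEquiv r x) (blockEquiv r y) =
      Matrix.fromBlocks (Matrix.fromBlocks A 0 0 1) 0 0 B x y := by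
  simp [blockMatrix]

lemma blockMatrix_mul (r : ℕ) (A B C D : Matrix (Fin 2) (Fin 2) F) :
    blockMatrix r (A * C) (B * D) = blockMatrix r A B * blockMatrix r C D := by
  rw [blockMatrix, blockMatrix, blockMatrix, ← map_mul]
  simp [Matrix.fromBlocks_multiply]

lemma blockMatrix_one (r : ℕ) : blockMatrix r (1 : Matrix (Fin 2) (Fin 2) F) 1 = 1 := by
  rw [blockMatrix, Matrix.fromBlocks_one, Matrix.fromBlocks_one, map_one]

lemma blockMatrix_twisted (hφ : ∀ x, φ (φ x) = x) (r : ℕ) (A : GL (Fin 2) F)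
    (i j : Fin (r + 2 * 2)) :
    blockMatrix r A.val (twistedFrobenius F φ 2 A).val i j =
      φ (blockMatrix r (A⁻¹).val (twistedFrobenius F φ 2 A⁻¹).val j.rev i.rev) := by
  have hl : ∀ a : Fin 2, (blockEquiv r (.inl (.inl a))).rev = blockEquiv r (.inr a.rev) :=
    fun a => Fin.ext (by rw [Fin.val_rev, blockEquiv_left, blockEquiv_right, Fin.val_rev]; omega)
  have hm : ∀ a : Fin r, (blockEquiv r (.inl (.inr a))).rev = blockEquiv r (.inl (.inr a.rev)) :=
    fun a => Fin.ext (by rw [Fin.val_rev, blockEquiv_mid, blockEquiv_mid, Fin.val_rev]; omega)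
  have hr : ∀ a : Fin 2, (blockEquiv r (.inr a)).rev = blockEquiv r (.inl (.inl a.rev)) :=
    fun a => Fin.ext (by rw [Fin.val_rev, blockEquiv_left, blockEquiv_right, Fin.val_rev]; omega)
  obtain ⟨x, rfl⟩ := (blockEquiv r).surjective i
  obtain ⟨y, rfl⟩ := (blockEquiv r).surjective j
  rcases x with (x | x) | x <;> rcases y with (y | y) | y <;>
    simp only [hl, hm, hr, blockMatrix_apply, Matrix.fromBlocks_apply₁₁,
      Matrix.fromBlocks_apply₁₂, Matrix.fromBlocks_apply₂₁, Matrix.fromBlocks_apply₂₂,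
      Matrix.zero_apply, map_zero]
  · rw [twistedFrobenius_apply, inv_inv, hφ, Fin.rev_rev, Fin.rev_rev]
  · simp only [Matrix.one_apply, Fin.rev_inj, eq_comm (a := y)]
    split_ifs <;> simp
  · rw [twistedFrobenius_apply]

/-- The embedding `A ↦ diag(A, 1, A*)` of `GL_2(𝔽_{q²})` in `GU_{r+4}(q)`. -/
def leviHom (hφ : ∀ x, φ (φ x) = x) (r : ℕ) : GL (Fin 2) F →* GU F φ (r + 2 * 2) where
  toFun A :=
    ⟨⟨blockMatrix r A.val (twistedFrobenius F φ 2 A).val,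
      blockMatrix r (A⁻¹).val (twistedFrobenius F φ 2 A⁻¹).val,
      by rw [← blockMatrix_mul, ← Units.val_mul, ← Units.val_mul, ← map_mul, mul_inv_cancel,
        map_one, Units.val_one, blockMatrix_one],
      by rw [← blockMatrix_mul, ← Units.val_mul, ← Units.val_mul, ← map_mul, inv_mul_cancel,
        map_one, Units.val_one, blockMatrix_one]⟩,
      mem_GU_iff.2 (blockMatrix_twisted hφ r A)⟩
  map_one' := by
    refine Subtype.ext (Units.ext ?_)
    change blockMatrix r _ _ = 1
    rw [map_one, Units.val_one, blockMatrix_one]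
  map_mul' A B := by
    refine Subtype.ext (Units.ext ?_)
    change blockMatrix r _ _ = blockMatrix r _ _ * blockMatrix r _ _
    rw [map_mul, Units.val_mul, Units.val_mul, blockMatrix_mul]

lemma leviHom_val (hφ : ∀ x, φ (φ x) = x) (r : ℕ) (A : GL (Fin 2) F) :
    (leviHom hφ r A).val.val = blockMatrix r A.val (twistedFrobenius F φ 2 A).val := rfl

lemma leviHom_apply_left (hφ : ∀ x, φ (φ x) = x) (r : ℕ) (A : GL (Fin 2) F) (a b : Fin 2) :
    (leviHom hφ r A).val.val ⟨a, by omega⟩ ⟨b, by omega⟩ = A.val a b := by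
  have h : ∀ c : Fin 2, (⟨c, by omega⟩ : Fin (r + 2 * 2)) = blockEquiv r (.inl (.inl c)) :=
    fun c => Fin.ext (blockEquiv_left c).symm
  rw [leviHom_val, h a, h b, blockMatrix_apply]
  rfl

lemma leviHom_mem_Unr (hφ : ∀ x, φ (φ x) = x) (r : ℕ) {A : GL (Fin 2) F} (hA : A.val 1 0 = 0)
    (hA' : (A⁻¹).val 1 0 = 0) : leviHom hφ r A ∈ Unr F φ r 2 := by
  have hB : (twistedFrobenius F φ 2 A).val 1 0 = 0 := by
    rw [twistedFrobenius_apply]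
    exact (congrArg φ hA').trans (map_zero φ)
  have key : ∀ C : Matrix (Fin 2) (Fin 2) F, C 1 0 = 0 → ∀ a b : Fin 2, b < a → C a b = 0 := by
    intro C hC a b hab
    obtain rfl : a = 1 := by omega
    obtain rfl : b = 0 := by omega
    exact hC
  refine mem_Unr_two.2 ⟨fun i j hij => ?_, fun i j h1 h2 h3 h4 => ?_⟩
  · obtain ⟨x, rfl⟩ := (blockEquiv r).surjective i
    obtain ⟨y, rfl⟩ := (blockEquiv r).surjective j
    rw [Fin.lt_def] at hij
    rw [leviHom_val, blockMatrix_apply]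
    rcases x with (x | x) | x <;> rcases y with (y | y) | y <;>
      simp only [blockEquiv_left, blockEquiv_mid, blockEquiv_right] at hij <;>
      simp only [Matrix.fromBlocks_apply₁₁, Matrix.fromBlocks_apply₁₂,
        Matrix.fromBlocks_apply₂₁, Matrix.fromBlocks_apply₂₂, Matrix.zero_apply]
    · exact key _ hA x y (by omega)
    · exact Matrix.one_apply_ne (by rintro rfl; omega)
    · exact key _ hB x y (by omega)
  · obtain ⟨x, rfl⟩ := (blockEquiv r).surjective i
    obtain ⟨y, rfl⟩ := (blockEquiv r).surjective j
    rw [leviHom_val, blockMatrix_apply]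
    rcases x with (x | x) | x <;> rcases y with (y | y) | y <;>
      simp only [blockEquiv_left, blockEquiv_mid, blockEquiv_right] at h1 h2 h3 h4 <;>
      first
      | omega
      | simp [Matrix.one_apply]

/-- The elementary matrix with entry `a` in the upper right corner. -/
def upperGL (a : F) : GL (Fin 2) F :=
  ⟨!![1, a; 0, 1], !![1, -a; 0, 1], by simp [Matrix.one_fin_two], by simp [Matrix.one_fin_two]⟩

/-- The diagonal matrix `diag(-a⁻¹, a)`. -/
def diagGL {a : F} (ha : a ≠ 0) : GL (Fin 2) F :=
  ⟨!![-a⁻¹, 0; 0, a], !![-a, 0; 0, a⁻¹], by simp [Matrix.one_fin_two, ha],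
    by simp [Matrix.one_fin_two, ha]⟩

variable (F) in
/-- The permutation matrix of the transposition in `GL_2`. -/
def swapGL : GL (Fin 2) F :=
  ⟨!![0, 1; 1, 0], !![0, 1; 1, 0], by simp [Matrix.one_fin_two], by simp [Matrix.one_fin_two]⟩

lemma upperGL_neg_mul (a : F) : upperGL a * upperGL (-a) = 1 :=
  Units.ext (by simp [upperGL, Matrix.one_fin_two])

lemma swapGL_mul_swapGL : swapGL F * swapGL F = 1 :=
  Units.ext (by simp [swapGL, Matrix.one_fin_two])

lemma swapGL_conj_upperGL {a : F} (ha : a ≠ 0) :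
    swapGL F * upperGL a * swapGL F = upperGL a⁻¹ * diagGL ha * swapGL F * upperGL a⁻¹ :=
  Units.ext (by simp [swapGL, upperGL, diagGL, ha])

lemma leviHom_upperGL_mem (hφ : ∀ x, φ (φ x) = x) (r : ℕ) (a : F) :
    leviHom hφ r (upperGL a) ∈ Unr F φ r 2 :=
  leviHom_mem_Unr hφ r (by simp [upperGL]) (by simp [upperGL])

lemma leviHom_diagGL_mem (hφ : ∀ x, φ (φ x) = x) (r : ℕ) {a : F} (ha : a ≠ 0) :
    leviHom hφ r (diagGL ha) ∈ Unr F φ r 2 :=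
  leviHom_mem_Unr hφ r (by simp [diagGL]) (by simp [diagGL])

lemma leviHom_swapGL (hφ : ∀ x, φ (φ x) = x) (r : ℕ) :
    (leviHom hφ r (swapGL F)).val.val = permMat F (r + 2 * 2) (endSwap r) := by
  have hB : (twistedFrobenius F φ 2 (swapGL F)).val = !![0, 1; 1, 0] := by
    ext i j
    rw [twistedFrobenius_apply]
    fin_cases i <;> fin_cases j <;> simp [swapGL, Fin.rev]
  have hl : ∀ a : Fin 2, endSwap r (blockEquiv r (.inl (.inl a))) =
      blockEquiv r (.inl (.inl a.rev)) := by
    intro a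
    apply Fin.ext
    rw [endSwap_val, blockEquiv_left, blockEquiv_left, Fin.val_rev]
    split_ifs <;> omega
  have hm : ∀ a : Fin r, endSwap r (blockEquiv r (.inl (.inr a))) =
      blockEquiv r (.inl (.inr a)) := by
    intro a
    apply Fin.ext
    rw [endSwap_val, blockEquiv_mid]
    split_ifs <;> omega
  have hr : ∀ a : Fin 2, endSwap r (blockEquiv r (.inr a)) = blockEquiv r (.inr a.rev) := by
    intro a
    apply Fin.ext
    rw [endSwap_val, blockEquiv_right, blockEquiv_right, Fin.val_rev]
    split_ifs <;> omega
  have hJ : ∀ a b : Fin 2, (!![0, 1; 1, 0] : Matrix (Fin 2) (Fin 2) F) a b =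
      if a.rev = b then 1 else 0 := by
    intro a b
    fin_cases a <;> fin_cases b <;> simp [Fin.rev]
  ext i j
  obtain ⟨x, rfl⟩ := (blockEquiv r).surjective i
  obtain ⟨y, rfl⟩ := (blockEquiv r).surjective j
  rw [leviHom_val, blockMatrix_apply, hB, show (swapGL F).val = !![0, 1; 1, 0] from rfl]
  simp only [permMat, Matrix.of_apply]
  rcases x with (x | x) | x <;> rcases y with (y | y) | y <;>
    simp [hl, hm, hr, hJ, Matrix.one_apply]

lemma leviHom_upperGL_mul_apply (hφ : ∀ x, φ (φ x) = x) {r : ℕ} (a : F)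
    {u : GU F φ (r + 2 * 2)} (hu : u ∈ Unr F φ r 2) :
    (leviHom hφ r (upperGL a) * u).val.val ⟨0, by omega⟩ ⟨1, by omega⟩ =
      u.val.val ⟨0, by omega⟩ ⟨1, by omega⟩ + a * u.val.val ⟨1, by omega⟩ ⟨1, by omega⟩ := by
  rw [upperGU_mul_apply_succ (mem_Unr_two.1 (leviHom_upperGL_mem hφ r a)).1
    (mem_Unr_two.1 hu).1 rfl]
  have h0 := leviHom_apply_left hφ r (upperGL a) 0 0
  have h1 := leviHom_apply_left hφ r (upperGL a) 0 1
  simp only [upperGL, Matrix.of_apply, Matrix.cons_val', Matrix.cons_val_zero,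
    Matrix.cons_val_one] at h0 h1
  erw [h0, h1, one_mul]

lemma exists_leviHom_upperGL_mul (hφ : ∀ x, φ (φ x) = x) {r : ℕ} {u : GU F φ (r + 2 * 2)}
    (hu : u ∈ Unr F φ r 2) : ∃ a : F, ∃ v ∈ Unr F φ r 2,
      v.val.val ⟨0, by omega⟩ ⟨1, by omega⟩ = 0 ∧ u = leviHom hφ r (upperGL a) * v := by
  set x := u.val.val ⟨0, by omega⟩ ⟨1, by omega⟩ with hx
  set y := u.val.val ⟨1, by omega⟩ ⟨1, by omega⟩ with hy
  have hy0 : y ≠ 0 := upperGU_diag_ne_zero (show u ∈ upperGU F φ _ from (mem_Unr_two.1 hu).1) _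
  refine ⟨x / y, leviHom hφ r (upperGL (-(x / y))) * u,
    mul_mem (leviHom_upperGL_mem hφ r _) hu, ?_, ?_⟩
  · rw [leviHom_upperGL_mul_apply hφ _ hu, ← hx, ← hy]
    field_simp
    ring
  · rw [← mul_assoc, ← map_mul, upperGL_neg_mul, map_one, one_mul]

lemma conj_endSwap_mem_or (hφ : ∀ x, φ (φ x) = x) {r : ℕ} {σ : GU F φ (r + 2 * 2)}
    (hσ : σ.val.val = permMat F (r + 2 * 2) (endSwap r)) {u : GU F φ (r + 2 * 2)}
    (hu : u ∈ Unr F φ r 2) :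
    σ * u * σ ∈ Unr F φ r 2 ∨
      ∃ b ∈ Unr F φ r 2, ∃ c ∈ Unr F φ r 2, σ * u * σ = b * σ * c := by
  obtain ⟨a, v, hv, hv0, rfl⟩ := exists_leviHom_upperGL_mul hφ hu
  have hσv := (conj_endSwap_mem_iff hσ hv).2 hv0
  have hσl : σ = leviHom hφ r (swapGL F) :=
    Subtype.ext (Units.ext (hσ.trans (leviHom_swapGL hφ r).symm))
  have hσσ : σ * σ = 1 := by rw [hσl, ← map_mul, swapGL_mul_swapGL, map_one]
  have hsplit : σ * (leviHom hφ r (upperGL a) * v) * σ =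
      σ * leviHom hφ r (upperGL a) * σ * (σ * v * σ) := by
    simp only [← mul_assoc]
    rw [mul_assoc _ σ σ, hσσ, mul_one]
  rw [hsplit]
  obtain rfl | ha := eq_or_ne a 0
  · left
    have h1 : upperGL (0 : F) = 1 := Units.ext (by simp [upperGL, Matrix.one_fin_two])
    rwa [h1, map_one, mul_one, hσσ, one_mul]
  · right
    have h := congrArg (leviHom hφ r) (swapGL_conj_upperGL ha)
    simp only [map_mul, ← hσl] at h
    exact ⟨_, mul_mem (leviHom_upperGL_mem hφ r a⁻¹) (leviHom_diagGL_mem hφ r ha), _,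
      mul_mem (leviHom_upperGL_mem hφ r a⁻¹) hσv, by rw [h, mul_assoc]⟩

lemma card_Unr_two (hφ : ∀ x, φ (φ x) = x) {r : ℕ} {σ : GU F φ (r + 2 * 2)}
    (hσ : σ.val.val = permMat F (r + 2 * 2) (endSwap r)) :
    Nat.card (Unr F φ r 2) =
      Nat.card F * Nat.card {u : Unr F φ r 2 // σ * u * σ ∈ Unr F φ r 2} := by
  rw [← Nat.card_prod]
  symm
  refine Nat.card_congr (Equiv.ofBijective (fun x : F × {u : Unr F φ r 2 //
    σ * u * σ ∈ Unr F φ r 2} =>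
      (⟨leviHom hφ r (upperGL x.1), leviHom_upperGL_mem hφ r x.1⟩ : Unr F φ r 2) * x.2.1)
    ⟨?_, ?_⟩)
  · rintro ⟨a, v, hv⟩ ⟨b, w, hw⟩ h
    have h1 : leviHom hφ r (upperGL a) * v.1 = leviHom hφ r (upperGL b) * w.1 :=
      congrArg Subtype.val h
    have h2 : v.1 = leviHom hφ r (upperGL (b - a)) * w.1 := by
      have h3 : upperGL (-a) * upperGL b = upperGL (b - a) :=
        Units.ext (by simp [upperGL, sub_eq_add_neg])
      have h4 : upperGL (-a) * upperGL a = 1 := by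
        simpa using upperGL_neg_mul (-a)
      rw [← h3, map_mul, mul_assoc, ← h1, ← mul_assoc, ← map_mul, h4, map_one, one_mul]
    have h5 := (conj_endSwap_mem_iff hσ v.2).1 hv
    rw [h2, leviHom_upperGL_mul_apply hφ _ w.2, (conj_endSwap_mem_iff hσ w.2).1 hw, zero_add] at h5
    have hab : b = a := sub_eq_zero.1 ((mul_eq_zero.1 h5).resolve_right
      (upperGU_diag_ne_zero (show w.1 ∈ upperGU F φ _ from (mem_Unr_two.1 w.2).1) _))
    subst hab
    have hvw : v = w := Subtype.ext (mul_left_cancel h1)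
    subst hvw
    rfl
  · rintro ⟨u, hu⟩
    obtain ⟨a, v, hv, hv0, rfl⟩ := exists_leviHom_upperGL_mul hφ hu
    exact ⟨⟨a, ⟨v, hv⟩, (conj_endSwap_mem_iff hσ hv).2 hv0⟩, rfl⟩

end UnitaryGroup

theorem statement3
    {F : Type*} [Field F] [Fintype F] [DecidableEq F]
    {R : Type*} [CommRing R]
    (p k q : ℕ) (hp : Nat.Prime p) (hk : 0 < k) (hq : q = p ^ k)
    (hcard : Fintype.card F = q ^ 2)
    (φ : F →+* F) (hφ : ∀ x : F, φ x = x ^ q)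
    (hR : IsUnit ((q : R) * ((q : R) ^ 2 - 1)))
    (r : ℕ)
    (σ : GU F φ (r + 2 * 2))
    (hσ : ((σ : GL (Fin (r + 2 * 2)) F) : Matrix (Fin (r + 2 * 2)) (Fin (r + 2 * 2)) F)
        = permMat F (r + 2 * 2)
            (Equiv.swap ⟨0, by omega⟩ ⟨1, by omega⟩ *
             Equiv.swap ⟨r + 2, by omega⟩ ⟨r + 3, by omega⟩)) :
    let e : MonoidAlgebra R ↥(GU F φ (r + 2 * 2)) := eSub R (Unr F φ r 2)
    let T : MonoidAlgebra R ↥(GU F φ (r + 2 * 2)) :=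
      (q : R) ^ 2 • (e * MonoidAlgebra.of R ↥(GU F φ (r + 2 * 2)) σ * e)
    T * T = ((q : R) ^ 2 - 1) • T + (q : R) ^ 2 • e := by
  intro e T
  have hφφ : ∀ x, φ (φ x) = x := by
    intro x
    rw [hφ, hφ, ← pow_mul, ← pow_two, ← hcard, FiniteField.pow_card]
  have h := eSub_quadratic_relation (R := R) (Unr F φ r 2) σ (q ^ 2)
    (fun u hu => conj_endSwap_mem_or hφφ hσ hu)
    (by rw [← hcard, ← Nat.card_eq_fintype_card]; exact card_Unr_two hφφ hσ)
  rwa [Nat.cast_pow] at h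
end

section
/- Let e ≥ 1 and d ∈ ℤ, and let λ be an e-core, so that τ_e(λ, d) = ((∅,…,∅), s) for some s = (s_1,…,s_e) ∈ ℤ^e with s_1+…+s_e = d. Then the number of boxes (x,y) ∈ Y(λ) with d + y − x ≡ 0 (mod e) equals Δ(s,1) − Δ(d,e), where Δ(s,1) = (1/2) Σ_{j=1}^{e} s_j(s_j − 1) and Δ(d,e) is computed for the 1-tuple (d). -/
/-- A partition, as a weakly decreasing, eventually zero, sequence of natural numbers.
Here `part u` is the `(u+1)`-st part `λ_{u+1}`. -/
structure PPartition where
  part : ℕ → ℕ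
  antitone' : Antitone part
  eventually_zero : ∃ N, part N = 0

namespace PPartition

/-- The Young diagram of a partition, with boxes indexed from `0`:
the box `(x, y)` (1-indexed `(x+1, y+1)`) belongs to `Y(λ)` iff `y < λ_{x+1}`.
The content `y - x` of a box is independent of the indexing convention. -/
def ydiag (lam : PPartition) : Set (ℕ × ℕ) :=
  {p | p.2 < lam.part p.1}

/-- The weight `|λ|` of a partition. -/
noncomputable def size (lam : PPartition) : ℕ :=
  ∑ᶠ u, lam.part u

/-- The β-set `β_d(λ) = {λ_u + d + 1 - u : u ≥ 1}` of the charged partition `(λ, d)`. -/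
def bset (lam : PPartition) (d : ℤ) : Set ℤ :=
  {z | ∃ u : ℕ, z = (lam.part u : ℤ) + d - u}

/-- `λ` is an `e`-core: it has no `e`-hook, i.e. there is no `x` with
`x + e ∈ β(λ)`, `x ∉ β(λ)` (this does not depend on the charge; we use charge `0`). -/
def IsECore (e : ℕ) (lam : PPartition) : Prop :=
  ∀ x : ℤ, x + e ∈ lam.bset 0 → x ∈ lam.bset 0

/-- `mu` is obtained from `lam` by removing one `e`-hook, i.e. by replacing some
`x + e` by `x` in the β-set. -/
def RemoveHookRel (e : ℕ) (lam mu : PPartition) : Prop :=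
  ∃ x : ℤ, x + e ∈ lam.bset 0 ∧ x ∉ lam.bset 0 ∧
    mu.bset 0 = insert x (lam.bset 0 \ {x + e})

/-- `nu` is obtained from `lam` by successively removing `w` `e`-hooks.
If moreover `nu` is an `e`-core, then `nu = λ_[e]` is the `e`-core of `lam` and
`w = w_e(λ)` is its `e`-weight. -/
def HookChainTo (e : ℕ) (lam nu : PPartition) (w : ℕ) : Prop :=
  ∃ c : ℕ → PPartition, c 0 = lam ∧ c w = nu ∧
    ∀ i < w, RemoveHookRel e (c i) (c (i + 1))

/-- The staircase partition `Δ_t = (t, t-1, …, 1)`. -/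
def staircase (t : ℕ) : PPartition where
  part u := t - u
  antitone' := by
    intro a b hab
    show t - b ≤ t - a
    omega
  eventually_zero := ⟨t, Nat.sub_self t⟩

/-- `τ_e(λ, d) = (μ, s)`: the `e`-quotient/`e`-charge decomposition of the charged
partition `(λ, d)`, characterized by `∑ s_p = d` and
`β_d(λ) = ⊔_{p=1}^e (p - e + e β_{s_p}(μ^p))` (here `p = j + 1` for `j : Fin e`). -/
def QuotientDecomp (e : ℕ) (lam : PPartition) (d : ℤ) (mu : Fin e → PPartition)
    (s : Fin e → ℤ) : Prop :=
  (∑ j, s j) = d ∧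
  lam.bset d = ⋃ j : Fin e,
    (fun z => ((j : ℕ) : ℤ) + 1 - (e : ℤ) + (e : ℤ) * z) '' ((mu j).bset (s j))

/-- The empty partition. -/
def empty : PPartition where
  part _ := 0
  antitone' := antitone_const
  eventually_zero := ⟨0, rfl⟩

/-- The 2-charge `σ_t` of the staircase `Δ_t`:
`σ_t = (-t/2, t/2)` if `t` is even, `σ_t = ((1+t)/2, -(1+t)/2)` if `t` is odd. -/
def sigmaT (t : ℕ) : ℤ × ℤ :=
  if Even t then (-((t : ℤ) / 2), (t : ℤ) / 2)
  else ((1 + (t : ℤ)) / 2, -((1 + (t : ℤ)) / 2))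

/-- The quantity `Δ(s, e)` of the paper, for a charge `s = (s_1, …, s_l)`:
`Δ(s,e) = ½ ∑_j ( s̄_j (1 - s̄_j/e) + s_j (s_j/e - 1) )`, where `s̄_j ∈ [0, e)`
is the residue of `s_j` modulo `e`. -/
def paperDelta {l : ℕ} (s : Fin l → ℤ) (e : ℕ) : ℚ :=
  (1 / 2) * ∑ j, ((((s j) % (e : ℤ) : ℤ) : ℚ) * (1 - (((s j) % (e : ℤ) : ℤ) : ℚ) / (e : ℚ))
    + ((s j : ℚ)) * ((s j : ℚ) / (e : ℚ) - 1))

end PPartition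

namespace PPartition

theorem paperDelta_eq_sum {l : ℕ} (s : Fin l → ℤ) (e : ℕ) :
    paperDelta s e = ∑ j, paperDelta (fun _ : Fin 1 => s j) e := by
  simp only [paperDelta, Fin.sum_univ_one, ← Finset.mul_sum]

/-- The one-term quantity `Δ` in terms of quotient and remainder. -/
theorem paperDelta_singleton (e : ℕ) (he : 1 ≤ e) (q r : ℤ) (hr : 0 ≤ r) (hre : r < e) :
    paperDelta (fun _ : Fin 1 => e * q + r) e = (q * (2 * r + e * q - e) : ℚ) / 2 := by
  have he' : (e : ℚ) ≠ 0 := by positivity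
  have hmod : (e * q + r) % (e : ℤ) = r := by
    rw [Int.mul_add_emod_self_left, Int.emod_eq_of_lt hr hre]
  simp only [paperDelta, Fin.sum_univ_one, hmod]
  push_cast
  field_simp
  ring

theorem paperDelta_succ (e : ℕ) (he : 1 ≤ e) (c : ℤ) :
    paperDelta (fun _ : Fin 1 => c + 1) e
      = paperDelta (fun _ : Fin 1 => c) e + ((c / (e : ℤ) : ℤ) : ℚ) := by
  have hpos : (0 : ℤ) < e := by exact_mod_cast he
  have hc := Int.mul_ediv_add_emod c e
  have hr0 := Int.emod_nonneg c hpos.ne'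
  have hr1 := Int.emod_lt_of_pos c hpos
  generalize c / (e : ℤ) = q at *
  generalize c % (e : ℤ) = r at *
  subst hc
  rw [paperDelta_singleton e he q r hr0 hr1]
  rcases lt_or_eq_of_le (Int.add_one_le_iff.mpr hr1) with h | h
  · rw [add_assoc, paperDelta_singleton e he q (r + 1) (by lia) h]
    push_cast
    ring
  · have hqr : (e : ℤ) * q + r + 1 = e * (q + 1) + 0 := by linear_combination h
    rw [hqr, paperDelta_singleton e he (q + 1) 0 le_rfl hpos]
    have h' : (e : ℚ) = r + 1 := by exact_mod_cast h.symm
    push_cast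
    rw [h']
    ring

theorem sum_range_ediv (e : ℕ) (he : 1 ≤ e) (d : ℤ) (n : ℕ) :
    ∑ u ∈ Finset.range n, (((d - u - 1) / (e : ℤ) : ℤ) : ℚ)
      = paperDelta (fun _ : Fin 1 => d) e - paperDelta (fun _ : Fin 1 => d - n) e := by
  induction n with
  | zero => simp
  | succ n ih =>
    have h := paperDelta_succ e he (d - n - 1)
    rw [sub_add_cancel] at h
    rw [Finset.sum_range_succ, ih, h, Nat.cast_succ, ← sub_sub d]
    ring

theorem card_range_filter_dvd (e : ℕ) (he : 1 ≤ e) (a : ℤ) (m : ℕ) :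
    (((Finset.range m).filter fun y : ℕ => (e : ℤ) ∣ a + y).card : ℤ)
      = (a + m - 1) / e - (a - 1) / e := by
  have hpos : (0 : ℤ) < e := by exact_mod_cast he
  induction m with
  | zero => simp
  | succ m ih =>
    have hstep : (a + m) / (e : ℤ) = (a + m - 1) / e + if (e : ℤ) ∣ a + m then 1 else 0 := by
      generalize a + (m : ℤ) = c
      split_ifs with h
      · obtain ⟨k, rfl⟩ := h
        rw [Int.mul_ediv_cancel_left _ hpos.ne']
        have : (e * k - 1 : ℤ) / e = k - 1 := by
          rw [Int.ediv_eq_iff_of_pos hpos]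
          constructor <;> nlinarith
        lia
      · rw [add_zero]
        have h0 := Int.emod_nonneg c hpos.ne'
        have h1 : c % e ≠ 0 := fun h' => h (Int.dvd_of_emod_eq_zero h')
        have h2 := Int.emod_lt_of_pos c hpos
        have h3 := Int.mul_ediv_add_emod c e
        symm
        rw [Int.ediv_eq_iff_of_pos hpos]
        constructor <;> nlinarith [lt_of_le_of_ne h0 h1.symm]
    rw [Finset.range_add_one, Finset.filter_insert]
    have hc : a + ((m + 1 : ℕ) : ℤ) - 1 = a + m := by push_cast; ring
    rw [hc, hstep]
    split_ifs with h
    · rw [Finset.card_insert_of_notMem (by simp)]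
      push_cast
      lia
    · lia

theorem mem_bset_empty (d z : ℤ) : z ∈ empty.bset d ↔ z ≤ d := by
  constructor
  · rintro ⟨u, rfl⟩
    simp [empty]
  · intro h
    exact ⟨(d - z).toNat, by simp [empty]; lia⟩

/-- Boxes with shifted content divisible by `e`, counted row by row. -/
theorem ncard_boxes (e : ℕ) (he : 1 ≤ e) (d : ℤ) (lam : PPartition) (N : ℕ)
    (hN : lam.part N = 0) :
    (Set.ncard {p : ℕ × ℕ | p ∈ lam.ydiag ∧ (e : ℤ) ∣ (d + (p.2 : ℤ) - (p.1 : ℤ))} : ℤ)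
      = ∑ u ∈ Finset.range N, ((lam.part u + d - u - 1) / (e : ℤ) - (d - u - 1) / (e : ℤ)) := by
  have hset : {p : ℕ × ℕ | p ∈ lam.ydiag ∧ (e : ℤ) ∣ (d + (p.2 : ℤ) - (p.1 : ℤ))}
      = ((((Finset.range N).sigma fun u =>
          (Finset.range (lam.part u)).filter fun y : ℕ => (e : ℤ) ∣ (d - u) + y).map
            (Equiv.sigmaEquivProd ℕ ℕ).toEmbedding : Finset (ℕ × ℕ)) : Set (ℕ × ℕ)) := by
    ext ⟨x, y⟩
    have hx : y < lam.part x → x < N := by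
      intro h
      by_contra! hle
      have := lam.antitone' hle
      lia
    have hxy : d + (y : ℤ) - x = d - x + y := by ring
    simp only [ydiag, Set.mem_ofPred_eq, hxy, Finset.coe_map, Set.mem_image, Finset.mem_coe,
      Finset.mem_sigma, Finset.mem_range, Finset.mem_filter, Equiv.coe_toEmbedding]
    constructor
    · rintro ⟨h, h'⟩
      exact ⟨⟨x, y⟩, ⟨hx h, h, h'⟩, rfl⟩
    · rintro ⟨⟨x', y'⟩, ⟨-, h, h'⟩, heq⟩
      obtain ⟨rfl, rfl⟩ := Prod.mk.inj heq
      exact ⟨h, h'⟩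
  rw [hset, Set.ncard_coe_finset, Finset.card_map, Finset.card_sigma]
  push_cast
  refine Finset.sum_congr rfl fun u _ => ?_
  rw [card_range_filter_dvd e he]
  congr 2
  ring

/-- Summing over the beads of an abacus above a flush level `-e * K`, row by row or
runner by runner. -/
theorem sum_beads (e : ℕ) (he : 1 ≤ e) (d : ℤ) (lam : PPartition) (s : Fin e → ℤ)
    (hquot : QuotientDecomp e lam d (fun _ => PPartition.empty) s)
    (N : ℕ) (K : ℤ) (hNK : d - N = -(e * K)) (hN : lam.part N = 0) :
    ∑ u ∈ Finset.range N, (((lam.part u + d - u - 1) / (e : ℤ) : ℤ) : ℚ)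
      = ∑ j, ∑ i ∈ Finset.range (s j + K).toNat, (((s j - i - 1) / ((1 : ℕ) : ℤ) : ℤ) : ℚ) := by
  have hpos : (0 : ℤ) < e := by exact_mod_cast he
  let b : ℕ → ℤ := fun u => lam.part u + d - u
  let r : (Σ _ : Fin e, ℕ) → ℤ := fun p => (p.1 : ℕ) + 1 - e + e * (s p.1 - p.2)
  have hb : Function.Injective b := by
    apply StrictAnti.injective
    intro u v huv
    have := lam.antitone' huv.le
    simp only [b]
    lia
  have hrdiv (p : Σ _ : Fin e, ℕ) : (r p - 1) / e = s p.1 - p.2 - 1 := by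
    have := p.1.isLt
    rw [Int.ediv_eq_iff_of_pos hpos]
    simp only [r]
    constructor <;> nlinarith
  have hr : Function.Injective r := by
    rintro ⟨j, i⟩ ⟨j', i'⟩ h
    have h1 := hrdiv ⟨j, i⟩
    rw [h, hrdiv] at h1
    simp only [r] at h h1
    have hz : s j - (i : ℤ) = s j' - i' := by lia
    rw [hz] at h
    obtain rfl : j = j' := Fin.ext (by lia)
    obtain rfl : i = i' := by lia
    rfl
  have himage : (Finset.range N).image b
      = (Finset.univ.sigma fun j => Finset.range (s j + K).toNat).image r := by
    ext c
    have hleft : c ∈ (Finset.range N).image b ↔ c ∈ lam.bset d ∧ -(e * K) < c := by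
      simp only [Finset.mem_image, Finset.mem_range, bset, Set.mem_ofPred_eq, b]
      constructor
      · rintro ⟨u, hu, rfl⟩
        exact ⟨⟨u, rfl⟩, by lia⟩
      · rintro ⟨⟨u, rfl⟩, hu⟩
        refine ⟨u, ?_, rfl⟩
        by_contra! hle
        have := lam.antitone' hle
        lia
    have hright : c ∈ (Finset.univ.sigma fun j => Finset.range (s j + K).toNat).image r
        ↔ c ∈ lam.bset d ∧ -(e * K) < c := by
      rw [hquot.2]
      simp only [Finset.mem_image, Finset.mem_sigma, Finset.mem_univ, true_and, Finset.mem_range,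
        Set.mem_iUnion, Set.mem_image, mem_bset_empty]
      constructor
      · rintro ⟨⟨j, i⟩, hi, rfl⟩
        refine ⟨⟨j, s j - i, by lia, rfl⟩, ?_⟩
        have hi' : 1 - K ≤ s j - i := by simp only at hi; lia
        simp only [r]
        nlinarith
      · rintro ⟨⟨j, z, hz, rfl⟩, hlt⟩
        have hj := j.isLt
        have hzK : -K < z := by
          by_contra! hle
          nlinarith
        refine ⟨⟨j, (s j - z).toNat⟩, by simp only; lia, ?_⟩
        have : s j - ((s j - z).toNat : ℤ) = z := by lia
        simp only [r, this]
    rw [hleft, hright]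
  calc ∑ u ∈ Finset.range N, (((lam.part u + d - u - 1) / (e : ℤ) : ℤ) : ℚ)
      = ∑ c ∈ (Finset.range N).image b, (((c - 1) / (e : ℤ) : ℤ) : ℚ) := by
        rw [Finset.sum_image hb.injOn]
    _ = _ := by
        rw [himage, Finset.sum_image hr.injOn, Finset.sum_sigma]
        simp only [hrdiv, Nat.cast_one, Int.ediv_one]

end PPartition

open PPartition in
/-- Lemma `lem:Delta`: if `λ` is an `e`-core and `τ_e(λ, d) = (∅, s)` with
`s ∈ ℤ^e(d)`, then the number of boxes of `λ` whose `d`-shifted content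
`d + y - x` is divisible by `e` equals `Δ(s, 1) - Δ(d, e)`. -/
theorem statement8 (e : ℕ) (he : 1 ≤ e) (d : ℤ) (lam : PPartition)
    (hcore : IsECore e lam)
    (s : Fin e → ℤ)
    (hquot : QuotientDecomp e lam d (fun _ => PPartition.empty) s) :
    (Set.ncard {p : ℕ × ℕ | p ∈ lam.ydiag ∧ (e : ℤ) ∣ (d + (p.2 : ℤ) - (p.1 : ℤ))} : ℚ)
      = paperDelta s 1 - paperDelta (fun _ : Fin 1 => d) e := by
  have hpos : (1 : ℤ) ≤ e := by exact_mod_cast he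
  obtain ⟨N₀, hN₀⟩ := lam.eventually_zero
  obtain ⟨K, hK⟩ : ∃ K : ℤ, K = |d| + N₀ + ∑ j, |s j| := ⟨_, rfl⟩
  have hsum : 0 ≤ ∑ j, |s j| := Finset.sum_nonneg fun j _ => abs_nonneg _
  have hs (j : Fin e) : 0 ≤ s j + K := by
    have h1 := Finset.single_le_sum (f := fun j => |s j|) (fun j _ => abs_nonneg _)
      (Finset.mem_univ j)
    have h2 := neg_abs_le (s j)
    have h3 := abs_nonneg d
    lia
  have hdK : (N₀ : ℤ) ≤ d + e * K := by
    have h1 := neg_abs_le d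
    have h2 := abs_nonneg d
    nlinarith
  obtain ⟨N, hN⟩ : ∃ N : ℕ, (N : ℤ) = d + e * K := ⟨(d + e * K).toNat, by lia⟩
  have hpart : lam.part N = 0 := by
    have := lam.antitone' (show N₀ ≤ N by lia)
    lia
  have hNK : d - N = -(e * K) := by lia
  have hcard := congrArg (Int.cast : ℤ → ℚ) (ncard_boxes e he d lam N hpart)
  push_cast at hcard
  rw [hcard, Finset.sum_sub_distrib, sum_beads e he d lam s hquot N K hNK hpart,
    sum_range_ediv e he, hNK, paperDelta_eq_sum s 1]
  have hrunner (j : Fin e) :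
      ∑ i ∈ Finset.range (s j + K).toNat, (((s j - i - 1) / ((1 : ℕ) : ℤ) : ℤ) : ℚ)
        = paperDelta (fun _ : Fin 1 => s j) 1 - paperDelta (fun _ : Fin 1 => -K) 1 := by
    rw [sum_range_ediv 1 le_rfl, Int.toNat_of_nonneg (hs j), sub_add_cancel_left]
  have hflush : paperDelta (fun _ : Fin 1 => -(e * K)) e
      = e * paperDelta (fun _ : Fin 1 => -K) 1 := by
    have h1 := paperDelta_singleton e he (-K) 0 le_rfl (by lia)
    have h2 := paperDelta_singleton 1 le_rfl (-K) 0 le_rfl (by lia)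
    simp only [Nat.cast_one, one_mul, add_zero, mul_neg] at h1 h2
    rw [h1, h2]
    push_cast
    ring
  simp only [hrunner, Finset.sum_sub_distrib, Finset.sum_const, Finset.card_univ, Fintype.card_fin,
    nsmul_eq_mul, hflush]
  ring
end
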